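/- Let α ≥ 1 and let r′ be a maximal repetition in a word w. Then the number of maximal repetitions r″ of w with p(r″) = p(r′), |r″| ≥ |r′|, beg(r″) > beg(r′) and beg(r″) − beg(r′) ≤ α·|r′| (i.e., maximal repetitions with the same minimal period, at least as long as r′, that are α-close to r′ from the right) is less than 2α. -/

import Mathlib

variable {A : Type*}

/-- `p` is a period of the factor `w[i..j]` of the word `w` (positions are 1-based):
`1 ≤ p ≤ j - i + 1` and `w[k] = w[k+p]` whenever both positions lie in `[i, j]`. -/
def IsPeriodOf (w : ℕ → A) (i j p : ℕ) : Prop :=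
  1 ≤ p ∧ p ≤ j - i + 1 ∧ ∀ k, i ≤ k → k + p ≤ j → w k = w (k + p)

/-- The minimal period of the factor `w[i..j]`. -/
noncomputable def minPer (w : ℕ → A) (i j : ℕ) : ℕ :=
  sInf {p | IsPeriodOf w i j p}

/-- The maximality conditions for a factor `w[i..j]` of the word `w` of length `n`,
with respect to its minimal period: it cannot be extended to the left or to the right
by one letter preserving the minimal period. -/
def MaxCond (n : ℕ) (w : ℕ → A) (i j : ℕ) : Prop :=
  (1 < i → w (i - 1) ≠ w (i + minPer w i j - 1)) ∧
  (j < n → w (j + 1) ≠ w (j - minPer w i j + 1))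

/-- `w[i..j]` is a maximal repetition (run) in the word `w` of length `n`. -/
def IsMaxRepetition (n : ℕ) (w : ℕ → A) (i j : ℕ) : Prop :=
  1 ≤ i ∧ i ≤ j ∧ j ≤ n ∧ 2 * minPer w i j ≤ j - i + 1 ∧ MaxCond n w i j

/-- `w[i..j]` is a maximal subrepetition in the word `w` of length `n`:
its exponent is strictly between 1 and 2 and it satisfies the maximality conditions. -/
def IsMaxSubrepetition (n : ℕ) (w : ℕ → A) (i j : ℕ) : Prop :=
  1 ≤ i ∧ i ≤ j ∧ j ≤ n ∧ minPer w i j < j - i + 1 ∧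
    j - i + 1 < 2 * minPer w i j ∧ MaxCond n w i j

/-- A repeat in the word `w` of length `n`: a pair of equal factors
`w[b1..e1]` (left copy) and `w[b2..e2]` (right copy) with `b1 < b2`. -/
structure WordRepeat (n : ℕ) (w : ℕ → A) where
  b1 : ℕ
  e1 : ℕ
  b2 : ℕ
  e2 : ℕ
  one_le_b1 : 1 ≤ b1
  b1_le_e1 : b1 ≤ e1
  b2_le_e2 : b2 ≤ e2
  e2_le_n : e2 ≤ n
  b1_lt_b2 : b1 < b2
  len_eq : e1 - b1 = e2 - b2
  copies_eq : ∀ k, k ≤ e1 - b1 → w (b1 + k) = w (b2 + k)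

namespace WordRepeat

variable {n : ℕ} {w : ℕ → A}

/-- The period of the repeat. -/
def p (σ : WordRepeat n w) : ℕ := σ.b2 - σ.b1

/-- The length of the copies of the repeat. -/
def c (σ : WordRepeat n w) : ℕ := σ.e1 - σ.b1 + 1

/-- The repeat is maximal: its copies cannot be simultaneously extended to the left
or to the right preserving the period. (`fact σ = w[b1..e2]`.) -/
def Maximal (σ : WordRepeat n w) : Prop :=
  (1 < σ.b1 → w (σ.b1 - 1) ≠ w (σ.b2 - 1)) ∧
  (σ.e2 < n → w (σ.e1 + 1) ≠ w (σ.e2 + 1))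

/-- The repeat is overlapped: its copies are overlapped factors. -/
def Overlapped (σ : WordRepeat n w) : Prop := σ.b2 ≤ σ.e1 + 1

/-- The repeat is gapped: there is a nonempty gap between its copies. -/
def Gapped (σ : WordRepeat n w) : Prop := σ.e1 + 1 < σ.b2

/-- The repeat is `α`-gapped: it is gapped and `p(σ) ≤ α ⬝ c(σ)`. -/
def AlphaGapped (α : ℝ) (σ : WordRepeat n w) : Prop :=
  σ.Gapped ∧ (σ.p : ℝ) ≤ α * (σ.c : ℝ)

/-- `σ` is covered by `σ'`: `fact σ = w[σ.b1..σ.e2]` is contained in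
`fact σ' = w[σ'.b1..σ'.e2]` and `p(σ') < p(σ)`. -/
def CoveredBy (σ σ' : WordRepeat n w) : Prop :=
  σ'.b1 ≤ σ.b1 ∧ σ.e2 ≤ σ'.e2 ∧ σ'.p < σ.p

end WordRepeat

/-- `σ` is the principal repeat of some maximal repetition of `w`
(a reprincipal repeat). -/
def IsPrincipalOfMaxRepetition {n : ℕ} {w : ℕ → A} (σ : WordRepeat n w) : Prop :=
  ∃ i j, IsMaxRepetition n w i j ∧ σ.b1 = i ∧ σ.e1 = j - minPer w i j ∧
    σ.b2 = i + minPer w i j ∧ σ.e2 = j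

/-- `σ` is principal: it is the principal repeat of some maximal repetition or
maximal subrepetition of `w`. -/
def IsPrincipal {n : ℕ} {w : ℕ → A} (σ : WordRepeat n w) : Prop :=
  ∃ i j, (IsMaxRepetition n w i j ∨ IsMaxSubrepetition n w i j) ∧ σ.b1 = i ∧
    σ.e1 = j - minPer w i j ∧ σ.b2 = i + minPer w i j ∧ σ.e2 = j

/-- `σ` is a periodic repeat: its copies are repetitions whose minimal period
is at most `c(σ)/3`. -/
def IsPeriodicRepeat {n : ℕ} {w : ℕ → A} (σ : WordRepeat n w) : Prop :=
  3 * minPer w σ.b1 σ.e1 ≤ σ.c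

/-- The periodic repeat `σ` is represented by the maximal repetition `w[i..j]`:
both copies of `σ` extend (preserving their minimal period) to `w[i..j]`;
equivalently, `w[i..j]` is a maximal repetition whose minimal period equals the
minimal period of the copies of `σ` and which contains both copies of `σ`. -/
def RepresentedBy {n : ℕ} {w : ℕ → A} (σ : WordRepeat n w) (i j : ℕ) : Prop :=
  IsPeriodicRepeat σ ∧ IsMaxRepetition n w i j ∧
  minPer w i j = minPer w σ.b1 σ.e1 ∧ i ≤ σ.b1 ∧ σ.e2 ≤ j

/-- The periodic repeat `σ` is represented by the pair of distinct maximal repetitions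
`w[i1..j1]`, `w[i2..j2]`: the left copy of `σ` extends to `w[i1..j1]`, the right copy
extends to `w[i2..j2]`, the two repetitions being distinct (`σ` is birepresented). -/
def RepresentedByPair {n : ℕ} {w : ℕ → A} (σ : WordRepeat n w)
    (i1 j1 i2 j2 : ℕ) : Prop :=
  IsPeriodicRepeat σ ∧ IsMaxRepetition n w i1 j1 ∧ IsMaxRepetition n w i2 j2 ∧
  minPer w i1 j1 = minPer w σ.b1 σ.e1 ∧ minPer w i2 j2 = minPer w σ.b1 σ.e1 ∧
  i1 ≤ σ.b1 ∧ σ.e1 ≤ j1 ∧ i2 ≤ σ.b2 ∧ σ.e2 ≤ j2 ∧ ¬(i1 = i2 ∧ j1 = j2)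


theorem isPeriodOf_minPer (w : ℕ → A) {i j : ℕ} (hij : i ≤ j) :
    IsPeriodOf w i j (minPer w i j) :=
  Nat.sInf_mem (s := {p | IsPeriodOf w i j p})
    ⟨j - i + 1, by omega, le_rfl, fun _ _ _ => by omega⟩

/-- Two maximal repetitions with the same minimal period `p` and with overlap at least `p`
coincide. -/
theorem IsMaxRepetition.eq_of_overlap {n : ℕ} {w : ℕ → A} {i j i' j' : ℕ}
    (h : IsMaxRepetition n w i j) (h' : IsMaxRepetition n w i' j')
    (hp : minPer w i' j' = minPer w i j) (hii' : i ≤ i')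
    (hov : i' + minPer w i j ≤ j + 1) : i = i' ∧ j = j' := by
  obtain ⟨hi, hij, hjn, hlen, -, hmaxr⟩ := h
  obtain ⟨hi', hij', hjn', hlen', hmaxl', hmaxr'⟩ := h'
  obtain ⟨hpos, -, hper⟩ := isPeriodOf_minPer w hij
  obtain ⟨-, -, hper'⟩ := isPeriodOf_minPer w hij'
  rw [hp] at hper' hmaxl' hmaxr' hlen'
  generalize minPer w i j = p at *
  have hj'j : j' ≤ j := by
    by_contra! hlt
    apply hmaxr (by omega)
    rw [hper' (j - p + 1) (by omega) (by omega)]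
    congr 1
    omega
  have hi'i : i' ≤ i := by
    by_contra! hlt
    apply hmaxl' (by omega)
    rw [hper (i' - 1) (by omega) (by omega)]
    congr 1
    omega
  have hjj' : j ≤ j' := by
    by_contra! hlt
    apply hmaxr' (by omega)
    rw [hper (j' - p + 1) (by omega) (by omega)]
    congr 1
    omega
  omega

/-- Distinct maximal repetitions with the same minimal period `p`, the left one of length greater
than `l`, start at distance at least `l + 2 - p` from each other. -/
theorem IsMaxRepetition.add_le_of_ne {n : ℕ} {w : ℕ → A} {i j i' j' l : ℕ}
    (h : IsMaxRepetition n w i j) (h' : IsMaxRepetition n w i' j')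
    (hp : minPer w i' j' = minPer w i j) (hii' : i ≤ i') (hne : (i, j) ≠ (i', j'))
    (hl : l ≤ j - i) : i + (l + 2 - minPer w i j) ≤ i' := by
  by_contra! hlt
  have hij := h.2.1
  obtain ⟨rfl, rfl⟩ := h.eq_of_overlap h' hp hii' (by omega)
  exact hne rfl

/-- A set on which `f` takes values in `[D, B]` that are pairwise at distance at least `D` has at
most `B / D` elements. -/
theorem finite_and_ncard_le_of_separated {β : Type*} (s : Set β) (f : β → ℕ) {D : ℕ} {B : ℝ}
    (hD : 0 < D) (hlow : ∀ x ∈ s, D ≤ f x) (hup : ∀ x ∈ s, (f x : ℝ) ≤ B) (hB : 0 ≤ B)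
    (hsep : ∀ x ∈ s, ∀ y ∈ s, x ≠ y → f x ≤ f y → f x + D ≤ f y) :
    s.Finite ∧ (s.ncard : ℝ) ≤ B / D := by
  have hmaps : Set.MapsTo (fun x => f x / D) s (Finset.Icc 1 ⌊B / D⌋₊ : Finset ℕ) := by
    intro x hx
    rw [Finset.mem_coe, Finset.mem_Icc]
    refine ⟨(Nat.one_le_div_iff hD).2 (hlow x hx), Nat.le_floor (Nat.cast_div_le.trans ?_)⟩
    gcongr
    exact hup x hx
  have hlt : ∀ x ∈ s, ∀ y ∈ s, x ≠ y → f x ≤ f y → f x / D < f y / D := by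
    intro x hx y hy hne hle
    calc f x / D < f x / D + 1 := Nat.lt_succ_self _
      _ = (f x + D) / D := (Nat.add_div_right _ hD).symm
      _ ≤ f y / D := Nat.div_le_div_right (hsep x hx y hy hne hle)
  have hinj : Set.InjOn (fun x => f x / D) s := by
    intro x hx y hy hxy
    by_contra hne
    rcases le_total (f x) (f y) with hle | hle
    · exact (hlt x hx y hy hne hle).ne hxy
    · exact (hlt y hy x hx (Ne.symm hne) hle).ne hxy.symm
  refine ⟨Set.Finite.of_injOn hmaps hinj (Finset.finite_toSet _), ?_⟩
  have hcard := Set.ncard_le_ncard_of_injOn _ hmaps hinj (Finset.finite_toSet _)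
  rw [Set.ncard_coe_finset, Nat.card_Icc, Nat.add_sub_cancel] at hcard
  exact (Nat.cast_le.2 hcard).trans (Nat.floor_le (by positivity))

/-- Any maximal repetition `w[i1..j1]` has fewer than `2α` maximal repetitions `w[i2..j2]`
with the same minimal period, at least as long as it, starting strictly to the right of it,
and `α`-close to it from the right. -/
theorem card_alpha_close_lt {A : Type*} (α : ℝ) (hα : 1 ≤ α)
    (n : ℕ) (w : ℕ → A) (i1 j1 : ℕ) (hr : IsMaxRepetition n w i1 j1) :
    {q : ℕ × ℕ | IsMaxRepetition n w q.1 q.2 ∧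
        minPer w q.1 q.2 = minPer w i1 j1 ∧
        j1 - i1 ≤ q.2 - q.1 ∧ i1 < q.1 ∧
        (q.1 : ℝ) - (i1 : ℝ) ≤ α * ((j1 : ℝ) - (i1 : ℝ) + 1)}.Finite ∧
    ({q : ℕ × ℕ | IsMaxRepetition n w q.1 q.2 ∧
        minPer w q.1 q.2 = minPer w i1 j1 ∧
        j1 - i1 ≤ q.2 - q.1 ∧ i1 < q.1 ∧
        (q.1 : ℝ) - (i1 : ℝ) ≤ α * ((j1 : ℝ) - (i1 : ℝ) + 1)}.ncard : ℝ) < 2 * α := by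
  have hij := hr.2.1
  have hlen := hr.2.2.2.1
  have hpos := (isPeriodOf_minPer w hij).1
  have hB : (0 : ℝ) < α * ((j1 : ℝ) - i1 + 1) := by
    have : (i1 : ℝ) ≤ j1 := by exact_mod_cast hij
    have : (0 : ℝ) < (j1 : ℝ) - i1 + 1 := by linarith
    positivity
  have hD : 0 < j1 - i1 + 2 - minPer w i1 j1 := by omega
  have hhalf : (j1 : ℝ) - i1 + 1 < 2 * ((j1 - i1 + 2 - minPer w i1 j1 : ℕ) : ℝ) := by
    have : j1 + 1 < 2 * (j1 - i1 + 2 - minPer w i1 j1) + i1 := by omega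
    have : (j1 : ℝ) + 1 < 2 * ((j1 - i1 + 2 - minPer w i1 j1 : ℕ) : ℝ) + i1 := by
      exact_mod_cast this
    linarith
  refine (finite_and_ncard_le_of_separated _ (fun q : ℕ × ℕ => q.1 - i1) hD ?_ ?_ hB.le ?_).imp_right
    fun h => h.trans_lt ?_
  · rintro ⟨i, j⟩ ⟨hq, hp, -, hlt, -⟩
    have hne : (i1, j1) ≠ (i, j) := fun he => hlt.ne (congrArg Prod.fst he)
    have := hr.add_le_of_ne hq hp hlt.le hne le_rfl
    dsimp only
    omega
  · rintro ⟨i, j⟩ ⟨-, -, -, hlt, hclose⟩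
    rwa [Nat.cast_sub hlt.le]
  · rintro ⟨i, j⟩ ⟨hq, hp, hl, hlt, -⟩ ⟨i', j'⟩ ⟨hq', hp', -, hlt', -⟩ hne hle
    dsimp only at *
    have := hq.add_le_of_ne hq' (hp'.trans hp.symm) (by omega) hne hl
    omega
  · rw [div_lt_iff₀ (by exact_mod_cast hD)]
    nlinarith
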